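/- Let I ⊆ K[X][U] be any polynomial ideal. The union of the Gröbner cones C_≺(I) over all I-specific elimination orders ≺ for the elimination of u_1,…,u_m is a star-shaped set with center Ω_u := {ω ∈ Ω : ω_1 = … = ω_n = 0}; that is, Ω_u is contained in this union, and for every I-specific elimination vector σ and every τ ∈ Ω_u, every point of the segment [σ,τ] lies in this union (i.e., is an I-specific elimination vector). -/

import Mathlib

open MvPolynomial

/-- A monomial order on exponent vectors in `Fin N →₀ ℕ`:
a linear order compatible with addition in which `0` is the least element. -/
structure MonoOrder (N : ℕ) where
  lt : (Fin N →₀ ℕ) → (Fin N →₀ ℕ) → Prop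
  total : ∀ a b, a = b ∨ lt a b ∨ lt b a
  trans : ∀ a b c, lt a b → lt b c → lt a c
  irrefl : ∀ a, ¬ lt a a
  add_right : ∀ a b c, lt a b → lt (a + c) (b + c)
  zero_lt : ∀ a, a ≠ 0 → lt 0 a

variable {N : ℕ} {K : Type*} [Field K]

/-- The ω-degree `ω · d` of an exponent vector `d`. -/
noncomputable def wdeg (ω : Fin N → ℝ) (d : Fin N → ℕ) : ℝ :=
  ∑ i, ω i * (d i : ℝ)

/-- The ≺-maximal exponent in the support of `p` (the exponent of the leading term). -/
noncomputable def leadExp (mo : MonoOrder N) (p : MvPolynomial (Fin N) K) : Fin N →₀ ℕ :=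
  open Classical in
  if h : ∃ d ∈ p.support, ∀ e ∈ p.support, e ≠ d → mo.lt e d then h.choose else 0

/-- The leading term `lt_≺(p)` of `p` w.r.t. the monomial order `mo`. -/
noncomputable def leadTerm (mo : MonoOrder N) (p : MvPolynomial (Fin N) K) :
    MvPolynomial (Fin N) K :=
  monomial (leadExp mo p) (p.coeff (leadExp mo p))

/-- `p ∈ K[X]`: the polynomial `p` involves only the first `n` variables. -/
def inKX (n : ℕ) (p : MvPolynomial (Fin N) K) : Prop :=
  ∀ d ∈ p.support, ∀ i : Fin N, n ≤ (i : ℕ) → d i = 0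

open Classical in
/-- Initial form `lt_ω(p)`: the sum of the terms of `p` of maximal ω-degree. -/
noncomputable def initForm (ω : Fin N → ℝ) (p : MvPolynomial (Fin N) K) :
    MvPolynomial (Fin N) K :=
  ∑ d ∈ p.support.filter (fun d : Fin N →₀ ℕ => ∀ e ∈ p.support, wdeg ω ⇑e ≤ wdeg ω ⇑d),
    monomial d (p.coeff d)

/-- The initial ideal `⟨lt_ω(I)⟩` w.r.t. a weight vector ω. -/
noncomputable def ltIdealW (ω : Fin N → ℝ) (I : Ideal (MvPolynomial (Fin N) K)) :
    Ideal (MvPolynomial (Fin N) K) :=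
  Ideal.span (initForm ω '' (I : Set (MvPolynomial (Fin N) K)))

/-- The initial ideal `⟨lt_≺(I)⟩` w.r.t. a monomial order. -/
noncomputable def ltIdealO (mo : MonoOrder N) (I : Ideal (MvPolynomial (Fin N) K)) :
    Ideal (MvPolynomial (Fin N) K) :=
  Ideal.span (leadTerm mo '' (I : Set (MvPolynomial (Fin N) K)))

/-- The Gröbner cone `C_≺(I)`. -/
noncomputable def gCone (mo : MonoOrder N) (I : Ideal (MvPolynomial (Fin N) K)) :
    Set (Fin N → ℝ) :=
  closure {ω | (∀ i, 0 ≤ ω i) ∧ ltIdealW ω I = ltIdealO mo I}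

/-- `G` is the normed reduced Gröbner basis of `I` w.r.t. `mo`. -/
def IsRedGB (mo : MonoOrder N) (I : Ideal (MvPolynomial (Fin N) K))
    (G : Set (MvPolynomial (Fin N) K)) : Prop :=
  G.Finite ∧ G ⊆ (I : Set (MvPolynomial (Fin N) K)) ∧
  Ideal.span (leadTerm mo '' G) = ltIdealO mo I ∧
  (∀ g ∈ G, g ≠ 0 ∧ g.coeff (leadExp mo g) = 1) ∧
  (∀ g ∈ G, ∀ h ∈ G, g ≠ h → ∀ d ∈ h.support, ¬ leadExp mo g ≤ d)

/-- `mo` is an `I`-specific elimination order for the last variables: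
every element of the reduced Gröbner basis whose leading term lies in `K[X]`
lies itself in `K[X]`. -/
def IsEO (n : ℕ) (mo : MonoOrder N) (I : Ideal (MvPolynomial (Fin N) K)) : Prop :=
  ∀ G : Set (MvPolynomial (Fin N) K), IsRedGB mo I G →
    ∀ g ∈ G, inKX n (leadTerm mo g) → inKX n g

/-- `ω` is an `I`-specific elimination vector. -/
def IsEV (n : ℕ) (I : Ideal (MvPolynomial (Fin N) K)) (ω : Fin N → ℝ) : Prop :=
  (∀ i, 0 ≤ ω i) ∧ ∃ mo : MonoOrder N, IsEO n mo I ∧ ω ∈ gCone mo I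

/-- The monomial order `mo` refines the weight vector `ω`. -/
def Refines (mo : MonoOrder N) (ω : Fin N → ℝ) : Prop :=
  ∀ d e : Fin N →₀ ℕ, wdeg ω ⇑d < wdeg ω ⇑e → mo.lt d e

/-- `Ω_u`: the set of weight vectors vanishing on the first `n` coordinates. -/
def OmegaU (n N : ℕ) : Set (Fin N → ℝ) :=
  {ω | (∀ i, 0 ≤ ω i) ∧ ∀ i : Fin N, (i : ℕ) < n → ω i = 0}

/-- `L_{X,≺}(G)`: the elements of `G` whose leading term lies in `K[X]`. -/
def LXset (n : ℕ) (mo : MonoOrder N) (G : Set (MvPolynomial (Fin N) K)) :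
    Set (MvPolynomial (Fin N) K) :=
  {p ∈ G | inKX n (leadTerm mo p)}
lemma castAdd_inj (n m : ℕ) : Function.Injective (Fin.castAdd m : Fin n → Fin (n + m)) := by
  intro a b h
  exact Fin.ext (by simpa using congrArg Fin.val h)

/-- Extend an exponent vector on the first `n` variables to all `n + m` variables. -/
noncomputable def extExp (n m : ℕ) (a : Fin n →₀ ℕ) : Fin (n + m) →₀ ℕ :=
  Finsupp.mapDomain (Fin.castAdd m) a

/-- The restriction of a monomial order on `K[X][U]` to the monomials of `K[X]`. -/
noncomputable def restrictOrder (n m : ℕ) (mo : MonoOrder (n + m)) : MonoOrder n where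
  lt a b := mo.lt (extExp n m a) (extExp n m b)
  total a b := by
    rcases mo.total (extExp n m a) (extExp n m b) with h | h | h
    · exact Or.inl (Finsupp.mapDomain_injective (castAdd_inj n m) h)
    · exact Or.inr (Or.inl h)
    · exact Or.inr (Or.inr h)
  trans a b c hab hbc := mo.trans _ _ _ hab hbc
  irrefl a := mo.irrefl _
  add_right a b c h := by
    show mo.lt (extExp n m (a + c)) (extExp n m (b + c))
    rw [show extExp n m (a + c) = extExp n m a + extExp n m c from Finsupp.mapDomain_add,
        show extExp n m (b + c) = extExp n m b + extExp n m c from Finsupp.mapDomain_add]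
    exact mo.add_right _ _ _ h
  zero_lt a ha := by
    show mo.lt (extExp n m 0) (extExp n m a)
    have h0 : extExp n m (0 : Fin n →₀ ℕ) = 0 := Finsupp.mapDomain_zero
    rw [h0]
    refine mo.zero_lt _ (fun h => ha ?_)
    exact Finsupp.mapDomain_injective (castAdd_inj n m) (h.trans h0.symm)

/-- The projection `K[X][U] → K[X]` sending each `u`-variable to `0`;
on polynomials of `K[X]` it inverts the canonical inclusion `K[X] → K[X][U]`. -/
noncomputable def projX (n m : ℕ) (K : Type*) [Field K] :
    MvPolynomial (Fin (n + m)) K →ₐ[K] MvPolynomial (Fin n) K :=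
  aeval (fun i : Fin (n + m) => if h : (i : ℕ) < n then X ⟨(i : ℕ), h⟩ else 0)

/-- The elimination ideal `I ∩ K[X]`, viewed as an ideal of `K[x_1,…,x_n]` via the
canonical inclusion `K[X] → K[X][U]`. -/
noncomputable def elimIdeal (n m : ℕ) {K : Type*} [Field K]
    (I : Ideal (MvPolynomial (Fin (n + m)) K)) : Ideal (MvPolynomial (Fin n) K) :=
  Ideal.comap
    (rename (Fin.castAdd m) : MvPolynomial (Fin n) K →ₐ[K] MvPolynomial (Fin (n + m)) K) I

/-- Priority of the variables for the lex order `u_1 ≻ … ≻ u_m ≻ x_1 ≻ … ≻ x_n`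
(smaller priority value = more significant variable). -/
def uPrio (n m : ℕ) (i : Fin (n + m)) : ℕ :=
  if (i : ℕ) < n then m + (i : ℕ) else (i : ℕ) - n

/-- The pure lexicographic order with `u_1 ≻ … ≻ u_m ≻ x_1 ≻ … ≻ x_n`:
`a <_lex b` iff at the most significant position where they differ, `a` is smaller. -/
def uLexLt (n m : ℕ) (a b : Fin (n + m) →₀ ℕ) : Prop :=
  ∃ i : Fin (n + m), a i < b i ∧ ∀ j : Fin (n + m), uPrio n m j < uPrio n m i → a j = b j

/-! ### Monomial orders -/

section MonomialOrders

lemma MonoOrder.asymm (mo : MonoOrder N) {a b : Fin N →₀ ℕ} (h : mo.lt a b) : ¬ mo.lt b a :=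
  fun h' => mo.irrefl _ (mo.trans _ _ _ h h')

lemma MonoOrder.lt_of_le_of_ne (mo : MonoOrder N) {a b : Fin N →₀ ℕ} (h : a ≤ b) (hne : a ≠ b) :
    mo.lt a b := by
  obtain ⟨c, rfl⟩ := exists_add_of_le h
  have hc : c ≠ 0 := by
    rintro rfl
    simp at hne
  simpa [add_comm] using mo.add_right 0 c a (mo.zero_lt c hc)

lemma MonoOrder.wellFounded (mo : MonoOrder N) : WellFounded mo.lt := by
  have : IsStrictOrder (Fin N →₀ ℕ) mo.lt := { irrefl := mo.irrefl, trans := mo.trans }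
  rw [RelEmbedding.wellFounded_iff_isEmpty]
  refine ⟨fun f => ?_⟩
  obtain ⟨i, j, hij, hle⟩ := wellQuasiOrdered_le (α := Fin N →₀ ℕ) f
  have hlt : mo.lt (f j) (f i) := f.map_rel_iff.2 hij
  by_cases heq : f i = f j
  · exact mo.irrefl _ (heq ▸ hlt)
  · exact mo.asymm hlt (mo.lt_of_le_of_ne hle heq)

lemma MonoOrder.exists_max (mo : MonoOrder N) {s : Finset (Fin N →₀ ℕ)} (hs : s.Nonempty) :
    ∃ d ∈ s, ∀ e ∈ s, e ≠ d → mo.lt e d := by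
  classical
  induction hs using Finset.Nonempty.cons_induction with
  | singleton a => exact ⟨a, by simp⟩
  | cons a s ha hs ih =>
    obtain ⟨d, hd, hmax⟩ := ih
    rcases mo.total a d with rfl | h | h
    · exact absurd hd ha
    · refine ⟨d, by simp [hd], fun e he hne => ?_⟩
      rcases Finset.mem_cons.1 he with rfl | he
      · exact h
      · exact hmax e he hne
    · refine ⟨a, by simp, fun e he hne => ?_⟩
      rcases Finset.mem_cons.1 he with rfl | he
      · exact absurd rfl hne
      · by_cases hed : e = d
        · exact hed ▸ h
        · exact mo.trans _ _ _ (hmax e he hed) h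

/-- The lexicographic monomial order. -/
noncomputable def lexOrder (N : ℕ) : MonoOrder N where
  lt a b := (MonomialOrder.lex (σ := Fin N)).toSyn a < MonomialOrder.lex.toSyn b
  total a b := by
    rcases lt_trichotomy ((MonomialOrder.lex (σ := Fin N)).toSyn a) (MonomialOrder.lex.toSyn b)
      with h | h | h
    · exact Or.inr (Or.inl h)
    · exact Or.inl (MonomialOrder.lex.toSyn.injective h)
    · exact Or.inr (Or.inr h)
  trans a b c := lt_trans
  irrefl a := lt_irrefl _
  add_right a b c h := by
    rw [map_add, map_add]
    exact add_lt_add_left h _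
  zero_lt a ha := by
    rw [map_zero, MonomialOrder.toSyn_lt_iff_ne_zero, ne_eq, MonomialOrder.toSyn_eq_zero_iff]
    exact ha

lemma wdeg_add (ω : Fin N → ℝ) (a b : Fin N →₀ ℕ) :
    wdeg ω ⇑(a + b) = wdeg ω ⇑a + wdeg ω ⇑b := by
  simp [wdeg, mul_add, Finset.sum_add_distrib]

lemma wdeg_nonneg {ω : Fin N → ℝ} (hω : ∀ i, 0 ≤ ω i) (a : Fin N → ℕ) : 0 ≤ wdeg ω a :=
  Finset.sum_nonneg fun i _ => mul_nonneg (hω i) (Nat.cast_nonneg _)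

lemma wdeg_weight_add (ω ρ : Fin N → ℝ) (a : Fin N → ℕ) :
    wdeg (ω + ρ) a = wdeg ω a + wdeg ρ a := by
  simp [wdeg, add_mul, Finset.sum_add_distrib]

lemma wdeg_weight_smul (c : ℝ) (ω : Fin N → ℝ) (a : Fin N → ℕ) :
    wdeg (c • ω) a = c * wdeg ω a := by
  simp [wdeg, mul_assoc, Finset.mul_sum]

/-- Compare monomials by their `ω`-degree first and break ties with `mo`. -/
def refineOrder (ω : Fin N → ℝ) (hω : ∀ i, 0 ≤ ω i) (mo : MonoOrder N) : MonoOrder N where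
  lt a b := wdeg ω ⇑a < wdeg ω ⇑b ∨ (wdeg ω ⇑a = wdeg ω ⇑b ∧ mo.lt a b)
  total a b := by
    rcases lt_trichotomy (wdeg ω ⇑a) (wdeg ω ⇑b) with h | h | h
    · exact Or.inr (Or.inl (Or.inl h))
    · rcases mo.total a b with h' | h' | h'
      · exact Or.inl h'
      · exact Or.inr (Or.inl (Or.inr ⟨h, h'⟩))
      · exact Or.inr (Or.inr (Or.inr ⟨h.symm, h'⟩))
    · exact Or.inr (Or.inr (Or.inl h))
  trans a b c := by
    rintro (h | ⟨h, h'⟩) (k | ⟨k, k'⟩)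
    · exact Or.inl (h.trans k)
    · exact Or.inl (k ▸ h)
    · exact Or.inl (h ▸ k)
    · exact Or.inr ⟨h.trans k, mo.trans _ _ _ h' k'⟩
  irrefl a := by
    rintro (h | ⟨-, h⟩)
    · exact lt_irrefl _ h
    · exact mo.irrefl _ h
  add_right a b c := by
    rintro (h | ⟨h, h'⟩)
    · exact Or.inl (by rw [wdeg_add, wdeg_add]; linarith)
    · exact Or.inr ⟨by rw [wdeg_add, wdeg_add, h], mo.add_right _ _ _ h'⟩
  zero_lt a ha := by
    have h0 : wdeg ω ⇑(0 : Fin N →₀ ℕ) = 0 := by simp [wdeg]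
    rw [h0]
    rcases (wdeg_nonneg hω ⇑a).lt_or_eq with h | h
    · exact Or.inl h
    · exact Or.inr ⟨h, mo.zero_lt a ha⟩

lemma refineOrder_lt {ω : Fin N → ℝ} {hω : ∀ i, 0 ≤ ω i} {mo : MonoOrder N}
    {a b : Fin N →₀ ℕ} : (refineOrder ω hω mo).lt a b ↔
      wdeg ω ⇑a < wdeg ω ⇑b ∨ (wdeg ω ⇑a = wdeg ω ⇑b ∧ mo.lt a b) :=
  Iff.rfl

lemma wdeg_le_of_refineOrder_lt {ω : Fin N → ℝ} {hω : ∀ i, 0 ≤ ω i} {mo : MonoOrder N}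
    {a b : Fin N →₀ ℕ} (h : (refineOrder ω hω mo).lt a b) : wdeg ω ⇑a ≤ wdeg ω ⇑b := by
  rcases refineOrder_lt.1 h with h | h
  · exact h.le
  · exact h.1.le

end MonomialOrders

/-! ### Leading exponents -/

section LeadingExponents

/-- `d` is the exponent of the leading monomial of `p`. -/
def IsLead (mo : MonoOrder N) (p : MvPolynomial (Fin N) K) (d : Fin N →₀ ℕ) : Prop :=
  d ∈ p.support ∧ ∀ e ∈ p.support, e ≠ d → mo.lt e d

lemma exists_isLead (mo : MonoOrder N) {p : MvPolynomial (Fin N) K} (hp : p ≠ 0) :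
    ∃ d, IsLead mo p d :=
  mo.exists_max (Finset.nonempty_iff_ne_empty.2 (by simpa using hp))

lemma IsLead.ne_zero {mo : MonoOrder N} {p : MvPolynomial (Fin N) K} {d : Fin N →₀ ℕ}
    (h : IsLead mo p d) : p ≠ 0 := by
  rintro rfl
  simpa using h.1

lemma IsLead.unique {mo : MonoOrder N} {p : MvPolynomial (Fin N) K} {d e : Fin N →₀ ℕ}
    (hd : IsLead mo p d) (he : IsLead mo p e) : d = e := by
  by_contra hne
  exact mo.asymm (hd.2 e he.1 (Ne.symm hne)) (he.2 d hd.1 hne)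

lemma IsLead.leadExp_eq {mo : MonoOrder N} {p : MvPolynomial (Fin N) K} {d : Fin N →₀ ℕ}
    (hd : IsLead mo p d) : leadExp mo p = d := by
  have h : ∃ d ∈ p.support, ∀ e ∈ p.support, e ≠ d → mo.lt e d := ⟨d, hd⟩
  rw [leadExp, dif_pos h]
  exact IsLead.unique (mo := mo) (p := p) h.choose_spec hd

lemma isLead_leadExp (mo : MonoOrder N) {p : MvPolynomial (Fin N) K} (hp : p ≠ 0) :
    IsLead mo p (leadExp mo p) := by
  obtain ⟨d, hd⟩ := exists_isLead mo hp
  exact hd.leadExp_eq.symm ▸ hd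

lemma IsLead.monomial_mul {mo : MonoOrder N} {p : MvPolynomial (Fin N) K} {d : Fin N →₀ ℕ}
    (hd : IsLead mo p d) (c : Fin N →₀ ℕ) : IsLead mo (monomial c 1 * p) (d + c) := by
  refine ⟨?_, fun e he hne => ?_⟩
  · rw [mem_support_iff, add_comm, coeff_monomial_mul, one_mul]
    exact mem_support_iff.1 hd.1
  · rw [mem_support_iff, coeff_monomial_mul'] at he
    split_ifs at he with hc
    · obtain ⟨a, rfl⟩ := exists_add_of_le hc
      rw [add_comm c a] at hne ⊢
      refine mo.add_right _ _ _ (hd.2 a ?_ fun h => hne (by rw [h]))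
      rw [mem_support_iff]
      simpa using he
    · exact absurd rfl he

/-- The exponents of the leading monomials of the elements of `V`. -/
def leadSet (mo : MonoOrder N) (V : Submodule K (MvPolynomial (Fin N) K)) : Set (Fin N →₀ ℕ) :=
  {d | ∃ f ∈ V, IsLead mo f d}

lemma eq_zero_of_support_disjoint_leadSet (mo : MonoOrder N)
    {V : Submodule K (MvPolynomial (Fin N) K)} {p : MvPolynomial (Fin N) K} (hp : p ∈ V)
    (h : ∀ e ∈ p.support, e ∉ leadSet mo V) : p = 0 := by
  by_contra hne
  obtain ⟨d, hd⟩ := exists_isLead mo hne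
  exact h d hd.1 ⟨p, hp, hd⟩

/-- Every polynomial has a normal form modulo `V`. -/
lemma exists_normalForm (mo : MonoOrder N) (V : Submodule K (MvPolynomial (Fin N) K))
    (p : MvPolynomial (Fin N) K) :
    ∃ v ∈ V, ∀ e ∈ (p - v).support, e ∉ leadSet mo V := by
  classical
  suffices H : ∀ a, ∀ p : MvPolynomial (Fin N) K, IsLead mo p a →
      ∃ v ∈ V, ∀ e ∈ (p - v).support, e ∉ leadSet mo V by
    by_cases hp : p = 0
    · exact ⟨0, V.zero_mem, by simp [hp]⟩
    · obtain ⟨a, ha⟩ := exists_isLead mo hp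
      exact H a p ha
  intro a
  induction a using mo.wellFounded.induction with
  | _ a ih =>
  intro p ha
  have key : ∀ q : MvPolynomial (Fin N) K, (∀ e ∈ q.support, mo.lt e a) →
      ∃ v ∈ V, ∀ e ∈ (q - v).support, e ∉ leadSet mo V := by
    intro q hq
    by_cases hq0 : q = 0
    · exact ⟨0, V.zero_mem, by simp [hq0]⟩
    · obtain ⟨b, hb⟩ := exists_isLead mo hq0
      exact ih b (hq b hb.1) q hb
  by_cases haV : a ∈ leadSet mo V
  · obtain ⟨f, hf, hfa⟩ := haV
    obtain ⟨v, hv, hvs⟩ := key (p - (p.coeff a / f.coeff a) • f) (by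
      intro e he
      have hea : e ≠ a := by
        rintro rfl
        have hne := mem_support_iff.1 hfa.1
        rw [mem_support_iff, coeff_sub, coeff_smul, smul_eq_mul, div_mul_cancel₀ _ hne,
          sub_self] at he
        exact he rfl
      rcases Finset.mem_union.1 (support_sub _ _ _ he) with h | h
      · exact ha.2 e h hea
      · exact hfa.2 e (support_smul h) hea)
    refine ⟨(p.coeff a / f.coeff a) • f + v, V.add_mem (V.smul_mem _ hf) hv, ?_⟩
    rwa [← sub_sub]
  · obtain ⟨v, hv, hvs⟩ := key (p - monomial a (p.coeff a)) (by
      intro e he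
      have hea : e ≠ a := by
        rintro rfl
        simp at he
      refine ha.2 e ?_ hea
      rw [mem_support_iff, coeff_sub, coeff_monomial, if_neg hea.symm, sub_zero] at he
      exact mem_support_iff.2 he)
    refine ⟨v, hv, fun e he => ?_⟩
    by_cases hea : e = a
    · rwa [hea]
    · refine hvs e ?_
      rw [mem_support_iff] at he ⊢
      rwa [sub_right_comm, coeff_sub, coeff_monomial, if_neg (Ne.symm hea), sub_zero]

/-- Every leading exponent of `V` is attained by a monic, tail-reduced element. -/
lemma exists_tailReduced {mo : MonoOrder N} {V : Submodule K (MvPolynomial (Fin N) K)}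
    {d : Fin N →₀ ℕ} (hd : d ∈ leadSet mo V) :
    ∃ g ∈ V, IsLead mo g d ∧ g.coeff d = 1 ∧ ∀ e ∈ g.support, e ≠ d → e ∉ leadSet mo V := by
  obtain ⟨g, hg, hgs⟩ := exists_normalForm mo V (monomial d 1)
  have h1 : g.coeff d = 1 := by
    by_contra h
    refine hgs d ?_ hd
    rw [mem_support_iff, coeff_sub, coeff_monomial, if_pos rfl]
    exact sub_ne_zero.2 (Ne.symm h)
  have htail : ∀ e ∈ g.support, e ≠ d → e ∉ leadSet mo V := by
    intro e he hne
    refine hgs e ?_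
    rw [mem_support_iff] at he ⊢
    rwa [coeff_sub, coeff_monomial, if_neg hne.symm, zero_sub, neg_ne_zero]
  have hg0 : g ≠ 0 := by
    rintro rfl
    simp at h1
  obtain ⟨a, ha⟩ := exists_isLead mo hg0
  have had : a = d := by
    by_contra hne
    exact htail a ha.1 hne ⟨g, hg, ha⟩
  exact ⟨g, hg, had ▸ ha, h1, htail⟩

lemma leadSet_eq_of_subset {mo₁ mo₂ : MonoOrder N} {V : Submodule K (MvPolynomial (Fin N) K)}
    (h : leadSet mo₁ V ⊆ leadSet mo₂ V) : leadSet mo₁ V = leadSet mo₂ V := by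
  refine h.antisymm fun d hd => ?_
  by_contra hd₁
  obtain ⟨g, hg, hgd, -, htail⟩ := exists_tailReduced hd
  refine hgd.ne_zero (eq_zero_of_support_disjoint_leadSet mo₁ hg fun e he => ?_)
  by_cases hed : e = d
  · rwa [hed]
  · exact fun he₁ => htail e he hed (h he₁)

lemma mem_leadSet_of_le {mo : MonoOrder N} {I : Ideal (MvPolynomial (Fin N) K)}
    {d e : Fin N →₀ ℕ} (hd : d ∈ leadSet mo (I.restrictScalars K)) (hle : d ≤ e) :
    e ∈ leadSet mo (I.restrictScalars K) := by
  obtain ⟨c, rfl⟩ := exists_add_of_le hle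
  obtain ⟨f, hf, hfd⟩ := hd
  exact ⟨monomial c 1 * f, I.mul_mem_left _ hf, hfd.monomial_mul c⟩

lemma monomial_one_mem_of_monomial_mem {J : Ideal (MvPolynomial (Fin N) K)} {d : Fin N →₀ ℕ}
    {c : K} (hc : c ≠ 0) (h : monomial d c ∈ J) : monomial d (1 : K) ∈ J := by
  have := J.mul_mem_left (C c⁻¹) h
  rwa [C_mul_monomial, inv_mul_cancel₀ hc] at this

/-- Leading terms and monic leading monomials span the same ideal. -/
lemma span_leadTerm_image (mo : MonoOrder N) (G : Set (MvPolynomial (Fin N) K)) :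
    Ideal.span (leadTerm mo '' G) =
      Ideal.span ((fun d => monomial d (1 : K)) '' {d | ∃ f ∈ G, IsLead mo f d}) := by
  refine le_antisymm (Ideal.span_le.2 ?_) (Ideal.span_le.2 ?_)
  · rintro _ ⟨f, hf, rfl⟩
    by_cases hf0 : f = 0
    · simp [hf0, leadTerm]
    · have := Ideal.mul_mem_left (Ideal.span ((fun d => monomial d (1 : K)) ''
        {d | ∃ f ∈ G, IsLead mo f d})) (C (f.coeff (leadExp mo f)))
        (Ideal.subset_span ⟨_, ⟨f, hf, isLead_leadExp mo hf0⟩, rfl⟩)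
      rwa [C_mul_monomial, mul_one] at this
  · rintro _ ⟨d, ⟨f, hf, hd⟩, rfl⟩
    refine monomial_one_mem_of_monomial_mem (mem_support_iff.1 hd.1) (Ideal.subset_span ⟨f, hf, ?_⟩)
    rw [leadTerm, hd.leadExp_eq]

lemma ltIdealO_eq_span (mo : MonoOrder N) (I : Ideal (MvPolynomial (Fin N) K)) :
    ltIdealO mo I =
      Ideal.span ((fun d => monomial d (1 : K)) '' leadSet mo (I.restrictScalars K)) :=
  span_leadTerm_image mo _

lemma mem_ltIdealO {mo : MonoOrder N} {I : Ideal (MvPolynomial (Fin N) K)}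
    {p : MvPolynomial (Fin N) K} :
    p ∈ ltIdealO mo I ↔ ∀ d ∈ p.support, d ∈ leadSet mo (I.restrictScalars K) := by
  rw [ltIdealO_eq_span, mem_ideal_span_monomial_image]
  exact ⟨fun h d hd => (h d hd).elim fun e he => mem_leadSet_of_le he.1 he.2,
    fun h d hd => ⟨d, h d hd, le_rfl⟩⟩

end LeadingExponents

/-! ### Reduced Gröbner bases -/

section ReducedGroebnerBases

lemma exists_finite_generators (mo : MonoOrder N) (I : Ideal (MvPolynomial (Fin N) K)) :
    ∃ F : Set (Fin N →₀ ℕ), F.Finite ∧ F ⊆ leadSet mo (I.restrictScalars K) ∧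
      IsAntichain (· ≤ ·) F ∧ ∀ d ∈ leadSet mo (I.restrictScalars K), ∃ c ∈ F, c ≤ d := by
  set M := leadSet mo (I.restrictScalars K)
  have hanti : IsAntichain (· ≤ ·) {d | Minimal (· ∈ M) d} :=
    fun a ha b hb hne hle => hne (hle.antisymm (hb.2 ha.1 hle))
  refine ⟨_, WellQuasiOrderedLE.finite_of_isAntichain hanti, fun d hd => hd.1, hanti,
    fun d hd => ?_⟩
  obtain ⟨c, hcd, hc⟩ := exists_minimal_le_of_wellFoundedLT (· ∈ M) d hd
  exact ⟨c, hc, hcd⟩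

lemma exists_isRedGB (mo : MonoOrder N) (I : Ideal (MvPolynomial (Fin N) K)) :
    ∃ G : Set (MvPolynomial (Fin N) K), IsRedGB mo I G := by
  obtain ⟨F, hfin, hFM, hanti, hF⟩ := exists_finite_generators mo I
  choose! g hgI hlead hcoeff htail using
    fun d (hd : d ∈ leadSet mo (I.restrictScalars K)) => exists_tailReduced hd
  refine ⟨g '' F, hfin.image g, ?_, ?_, ?_, ?_⟩
  · rintro _ ⟨d, hd, rfl⟩
    exact hgI d (hFM hd)
  · refine le_antisymm (Ideal.span_mono (Set.image_mono ?_)) ?_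
    · rintro _ ⟨d, hd, rfl⟩
      exact hgI d (hFM hd)
    · intro p hp
      rw [span_leadTerm_image, mem_ideal_span_monomial_image]
      intro d hd
      obtain ⟨c, hc, hcd⟩ := hF d (mem_ltIdealO.1 hp d hd)
      exact ⟨c, ⟨g c, ⟨c, hc, rfl⟩, hlead c (hFM hc)⟩, hcd⟩
  · rintro _ ⟨d, hd, rfl⟩
    rw [(hlead d (hFM hd)).leadExp_eq]
    exact ⟨(hlead d (hFM hd)).ne_zero, hcoeff d (hFM hd)⟩
  · rintro _ ⟨c, hc, rfl⟩ _ ⟨d, hd, rfl⟩ hne e he hle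
    rw [(hlead c (hFM hc)).leadExp_eq] at hle
    by_cases hed : e = d
    · subst hed
      exact hanti hc hd (fun h => hne (by rw [h])) hle
    · exact htail d (hFM hd) e he hed (mem_leadSet_of_le (hFM hc) hle)

lemma IsRedGB.exists_le {mo : MonoOrder N} {I : Ideal (MvPolynomial (Fin N) K)}
    {G : Set (MvPolynomial (Fin N) K)} (hG : IsRedGB mo I G) {d : Fin N →₀ ℕ}
    (hd : d ∈ leadSet mo (I.restrictScalars K)) :
    ∃ g ∈ G, ∃ c, IsLead mo g c ∧ c ≤ d := by
  have h : monomial d (1 : K) ∈ ltIdealO mo I := by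
    rw [ltIdealO_eq_span]
    exact Ideal.subset_span ⟨d, hd, rfl⟩
  rw [← hG.2.2.1, span_leadTerm_image, mem_ideal_span_monomial_image] at h
  obtain ⟨c, ⟨g, hg, hc⟩, hle⟩ := h d (by simp [mem_support_iff])
  exact ⟨g, hg, c, hc, hle⟩

lemma IsRedGB.tail_notMem {mo : MonoOrder N} {I : Ideal (MvPolynomial (Fin N) K)}
    {G : Set (MvPolynomial (Fin N) K)} (hG : IsRedGB mo I G) {g : MvPolynomial (Fin N) K}
    (hg : g ∈ G) {d e : Fin N →₀ ℕ} (hd : IsLead mo g d) (he : e ∈ g.support) (hne : e ≠ d) :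
    e ∉ leadSet mo (I.restrictScalars K) := by
  intro heM
  obtain ⟨h, hh, c, hc, hle⟩ := hG.exists_le heM
  by_cases hhg : h = g
  · subst hhg
    obtain rfl := hc.unique hd
    exact mo.asymm (hd.2 e he hne) (mo.lt_of_le_of_ne hle hne.symm)
  · exact hG.2.2.2.2 h hh g hg hhg e he (hc.leadExp_eq.symm ▸ hle)

/-- The exponents of the monomials of `K[X]`. -/
def expKX (n : ℕ) (d : Fin N →₀ ℕ) : Prop :=
  ∀ i : Fin N, n ≤ (i : ℕ) → d i = 0

lemma expKX_of_le {n : ℕ} {d e : Fin N →₀ ℕ} (hle : d ≤ e) (he : expKX n e) : expKX n d :=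
  fun i hi => Nat.le_zero.1 ((hle i).trans (he i hi).le)

lemma inKX_leadTerm_iff {n : ℕ} {mo : MonoOrder N} {p : MvPolynomial (Fin N) K}
    {d : Fin N →₀ ℕ} (hd : IsLead mo p d) : inKX n (leadTerm mo p) ↔ expKX n d := by
  have h : (leadTerm mo p).support = {d} := by
    classical
    rw [leadTerm, hd.leadExp_eq, support_monomial, if_neg (mem_support_iff.1 hd.1)]
  simp [inKX, expKX, h]

/-- The elements of `I` that lie in `K[X]`, as a `K`-subspace of `K[X][U]`. -/
def idealKX (n : ℕ) (I : Ideal (MvPolynomial (Fin N) K)) :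
    Submodule K (MvPolynomial (Fin N) K) where
  carrier := {p | p ∈ I ∧ inKX n p}
  zero_mem' := ⟨I.zero_mem, by simp [inKX]⟩
  add_mem' := by
    classical
    rintro p q ⟨hp, hp'⟩ ⟨hq, hq'⟩
    refine ⟨I.add_mem hp hq, fun d hd => ?_⟩
    rcases Finset.mem_union.1 (support_add hd) with h | h
    · exact hp' d h
    · exact hq' d h
  smul_mem' c p := by
    rintro ⟨hp, hp'⟩
    exact ⟨(I.restrictScalars K).smul_mem c hp, fun d hd => hp' d (support_smul hd)⟩

/-- `mo` is an `I`-specific elimination order iff every leading exponent of `I` lying in `K[X]`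
is a leading exponent of `I ∩ K[X]`. -/
lemma isEO_iff {n : ℕ} {mo : MonoOrder N} {I : Ideal (MvPolynomial (Fin N) K)} :
    IsEO n mo I ↔ ∀ d ∈ leadSet mo (I.restrictScalars K), expKX n d →
      d ∈ leadSet mo (idealKX n I) := by
  classical
  constructor
  · intro h d hd hdX
    obtain ⟨G, hG⟩ := exists_isRedGB mo I
    obtain ⟨g, hg, c, hc, hle⟩ := hG.exists_le hd
    have hgX := h G hG g hg ((inKX_leadTerm_iff hc).2 (expKX_of_le hle hdX))
    obtain ⟨b, rfl⟩ := exists_add_of_le hle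
    refine ⟨monomial b 1 * g, ⟨I.mul_mem_left _ (hG.2.1 hg), fun e he i hi => ?_⟩,
      hc.monomial_mul b⟩
    rw [mem_support_iff, coeff_monomial_mul'] at he
    split_ifs at he with hbe
    · obtain ⟨a, rfl⟩ := exists_add_of_le hbe
      have ha : a i = 0 := hgX a (by rw [mem_support_iff]; simpa using he) i hi
      have hb : c i + b i = 0 := by simpa using hdX i hi
      simp only [Finsupp.add_apply]
      omega
    · exact absurd rfl he
  · intro h G hG g hg hlt
    have hd := isLead_leadExp mo (hG.2.2.2.1 g hg).1
    set d := leadExp mo g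
    have hdX := (inKX_leadTerm_iff hd).1 hlt
    obtain ⟨g', ⟨hgI, hgX⟩, hlead, hc, htail⟩ := exists_tailReduced (h d ⟨g, hG.2.1 hg, hd⟩ hdX)
    have hsub : g - g' = 0 := by
      refine eq_zero_of_support_disjoint_leadSet mo (V := I.restrictScalars K)
        (I.sub_mem (hG.2.1 hg) hgI) fun e he => ?_
      have hne : e ≠ d := by
        rintro rfl
        rw [mem_support_iff, coeff_sub, hc, (hG.2.2.2.1 g hg).2, sub_self] at he
        exact he rfl
      rcases Finset.mem_union.1 (support_sub _ _ _ he) with h' | h'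
      · exact hG.tail_notMem hg hd h' hne
      · exact fun heM => htail e h' hne (h e heM (hgX e h'))
    rwa [sub_eq_zero.1 hsub]

end ReducedGroebnerBases

/-! ### Weights representing finitely many comparisons -/

section Weights

/-- Finitely many vectors of a salient additively closed subset of `ℤ^N` lie strictly on one side
of a hyperplane through the origin with integral normal vector. -/
lemma exists_int_functional_pos {pos : (Fin N → ℤ) → Prop}
    (hadd : ∀ v w, pos v → pos w → pos (v + w)) (hzero : ¬ pos 0) (k : ℕ)
    (P : Fin k → Fin N → ℤ) (hP : ∀ i, pos (P i)) :
    ∃ ρ : Fin N → ℤ, ∀ i, 0 < ρ ⬝ᵥ P i := by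
  have hnsmul : ∀ (c : ℕ) v, pos v → pos ((c + 1) • v) := by
    intro c v hv
    induction c with
    | zero => simpa using hv
    | succ c ih =>
      rw [succ_nsmul]
      exact hadd _ _ ih hv
  have hzsmul : ∀ (c : ℤ) v, 0 < c → pos v → pos (c • v) := by
    intro c v hc hv
    obtain ⟨a, rfl⟩ : ∃ a : ℕ, c = ((a + 1 : ℕ) : ℤ) := ⟨c.toNat - 1, by omega⟩
    rw [natCast_zsmul]
    exact hnsmul a v hv
  induction k with
  | zero => exact ⟨0, fun i => i.elim0⟩
  | succ k ih =>
    obtain ⟨φ, hφ⟩ := ih (fun i => P i.succ) fun i => hP _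
    set q := P 0 with hq
    by_cases hφq : 0 < φ ⬝ᵥ q
    · exact ⟨φ, Fin.cases hφq hφ⟩
    obtain ⟨ψ, hψ⟩ := ih (fun i => (φ ⬝ᵥ P i.succ) • q + (-(φ ⬝ᵥ q)) • P i.succ) (by
      intro i
      rcases (not_lt.1 hφq).lt_or_eq with h | h
      · exact hadd _ _ (hzsmul _ _ (hφ i) (hP 0)) (hzsmul _ _ (by omega) (hP _))
      · rw [h, neg_zero, zero_smul, add_zero]
        exact hzsmul _ _ (hφ i) (hP 0))
    have hqq : 0 < q ⬝ᵥ q := by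
      refine lt_of_le_of_ne (Finset.sum_nonneg fun i _ => mul_self_nonneg _) fun h => ?_
      exact hzero (dotProduct_self_eq_zero.1 h.symm ▸ hP 0)
    set B : ℤ := ∑ i : Fin k, |q ⬝ᵥ P i.succ| + 1
    refine ⟨B • ((ψ ⬝ᵥ q) • φ - (φ ⬝ᵥ q) • ψ) + q, Fin.cases ?_ fun i => ?_⟩
    · simp only [add_dotProduct, smul_dotProduct, sub_dotProduct, smul_eq_mul, ← hq]
      nlinarith
    · have h1 := hψ i
      have h2 : |q ⬝ᵥ P i.succ| ≤ ∑ i : Fin k, |q ⬝ᵥ P i.succ| :=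
        Finset.single_le_sum (f := fun i : Fin k => |q ⬝ᵥ P i.succ|)
          (fun _ _ => abs_nonneg _) (Finset.mem_univ i)
      have h3 := neg_abs_le (q ⬝ᵥ P i.succ)
      have h4 := abs_nonneg (q ⬝ᵥ P i.succ)
      simp only [add_dotProduct, smul_dotProduct, sub_dotProduct, smul_eq_mul, dotProduct_add,
        dotProduct_smul] at h1 ⊢
      nlinarith

/-- Finitely many comparisons of a monomial order are induced by a nonnegative weight. -/
lemma exists_weight (mo : MonoOrder N) {S : Set ((Fin N →₀ ℕ) × (Fin N →₀ ℕ))} (hS : S.Finite)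
    (hlt : ∀ s ∈ S, mo.lt s.1 s.2) :
    ∃ ρ : Fin N → ℝ, (∀ i, 0 ≤ ρ i) ∧ ∀ s ∈ S, wdeg ρ ⇑s.1 < wdeg ρ ⇑s.2 := by
  set T : Set ((Fin N →₀ ℕ) × (Fin N →₀ ℕ)) :=
    S ∪ Set.range fun i => ((0 : Fin N →₀ ℕ), Finsupp.single i 1)
  have hTfin : T.Finite := hS.union (Set.finite_range _)
  have hTlt : ∀ s ∈ T, mo.lt s.1 s.2 := by
    rintro s (hs | ⟨i, rfl⟩)
    · exact hlt s hs
    · exact mo.zero_lt _ (by simp)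
  obtain ⟨k, f, -, hf⟩ := hTfin.fin_param
  have hmem : ∀ i, f i ∈ T := fun i => hf ▸ Set.mem_range_self i
  obtain ⟨ρ, hρ⟩ := exists_int_functional_pos
    (pos := fun v => ∃ a b : Fin N →₀ ℕ, mo.lt a b ∧ v = fun i => (b i : ℤ) - a i)
    (by
      rintro _ _ ⟨a, b, hab, rfl⟩ ⟨c, d, hcd, rfl⟩
      refine ⟨a + c, b + d, mo.trans _ _ _ (mo.add_right _ _ c hab) ?_, ?_⟩
      · simpa [add_comm] using mo.add_right _ _ b hcd
      · ext i
        simp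
        ring)
    (by
      rintro ⟨a, b, hab, h⟩
      have : a = b := by
        ext i
        have := congrFun h i
        simp only [Pi.zero_apply] at this
        omega
      exact mo.irrefl _ (this ▸ hab))
    k (fun i j => ((f i).2 j : ℤ) - (f i).1 j) (fun i => ⟨_, _, hTlt _ (hmem i), rfl⟩)
  have key : ∀ s ∈ T, wdeg (fun i => (ρ i : ℝ)) ⇑s.1 < wdeg (fun i => (ρ i : ℝ)) ⇑s.2 := by
    intro s hs
    obtain ⟨i, rfl⟩ : s ∈ Set.range f := hf ▸ hs
    have h : (0 : ℝ) < ((ρ ⬝ᵥ fun j => ((f i).2 j : ℤ) - (f i).1 j : ℤ) : ℝ) := by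
      exact_mod_cast hρ i
    rw [← sub_pos]
    convert h using 1
    simp [wdeg, dotProduct, mul_sub]
  refine ⟨fun i => (ρ i : ℝ), fun i => ?_, fun s hs => key s (Or.inl hs)⟩
  have h := key _ (Or.inr ⟨i, rfl⟩)
  have h' : 0 < ρ i := by simpa [wdeg, Finsupp.single_apply] using h
  exact Int.cast_nonneg h'.le

end Weights

/-! ### Gröbner cones -/

section GroebnerCones

lemma coeff_initForm (ω : Fin N → ℝ) (p : MvPolynomial (Fin N) K) (d : Fin N →₀ ℕ)
    [Decidable (∀ e ∈ p.support, wdeg ω ⇑e ≤ wdeg ω ⇑d)] :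
    (initForm ω p).coeff d =
      if ∀ e ∈ p.support, wdeg ω ⇑e ≤ wdeg ω ⇑d then p.coeff d else 0 := by
  classical
  simp only [initForm, coeff_sum, coeff_monomial, Finset.sum_ite_eq', Finset.mem_filter,
    mem_support_iff]
  by_cases h : p.coeff d = 0 <;> simp [h]

lemma mem_support_initForm {ω : Fin N → ℝ} {p : MvPolynomial (Fin N) K} {d : Fin N →₀ ℕ} :
    d ∈ (initForm ω p).support ↔
      d ∈ p.support ∧ ∀ e ∈ p.support, wdeg ω ⇑e ≤ wdeg ω ⇑d := by
  classical
  rw [mem_support_iff, coeff_initForm]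
  split_ifs with h
  · rw [mem_support_iff, and_iff_left h]
  · exact iff_of_false (fun h' => h' rfl) fun h' => h h'.2

/-- A weight in the Gröbner cone weakly favours the leading monomial of every tail-reduced
element of the ideal. -/
lemma wdeg_le_of_mem_gCone {mo : MonoOrder N} {I : Ideal (MvPolynomial (Fin N) K)}
    {σ : Fin N → ℝ} (hσ : σ ∈ gCone mo I) {g : MvPolynomial (Fin N) K} (hg : g ∈ I)
    {d : Fin N →₀ ℕ} (hd : d ∈ g.support)
    (htail : ∀ e ∈ g.support, e ≠ d → e ∉ leadSet mo (I.restrictScalars K))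
    {e : Fin N →₀ ℕ} (he : e ∈ g.support) : wdeg σ ⇑e ≤ wdeg σ ⇑d := by
  have hcont : ∀ a : Fin N →₀ ℕ, Continuous fun ω : Fin N → ℝ => wdeg ω ⇑a := by
    intro a
    unfold wdeg
    fun_prop
  have hclosed : IsClosed {ω : Fin N → ℝ | wdeg ω ⇑e ≤ wdeg ω ⇑d} :=
    isClosed_le (hcont e) (hcont d)
  refine closure_minimal ?_ hclosed hσ
  rintro ω ⟨-, hω⟩
  have hmem : initForm ω g ∈ ltIdealO mo I := hω ▸ Ideal.subset_span ⟨g, hg, rfl⟩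
  obtain ⟨a, ha, hmax⟩ := Finset.exists_max_image g.support (fun a => wdeg ω ⇑a) ⟨d, hd⟩
  have hlead := mem_ltIdealO.1 hmem a (mem_support_initForm.2 ⟨ha, hmax⟩)
  by_cases had : a = d
  · exact had ▸ hmax e he
  · exact absurd hlead (htail a ha had)

/-- A weight strictly favouring the leading monomials of suitable elements of the ideal computes
the initial ideal of the monomial order. -/
lemma ltIdealW_eq_ltIdealO {mo : MonoOrder N} {I : Ideal (MvPolynomial (Fin N) K)}
    {ν : Fin N → ℝ} (hν : ∀ i, 0 ≤ ν i)
    (h : ∀ d ∈ leadSet mo (I.restrictScalars K), ∃ g ∈ I, d ∈ g.support ∧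
      ∀ e ∈ g.support, e ≠ d → wdeg ν ⇑e < wdeg ν ⇑d) :
    ltIdealW ν I = ltIdealO mo I := by
  classical
  set mo' := refineOrder ν hν mo
  have hM : leadSet mo (I.restrictScalars K) = leadSet mo' (I.restrictScalars K) := by
    refine leadSet_eq_of_subset fun d hd => ?_
    obtain ⟨g, hg, hdg, hlt⟩ := h d hd
    exact ⟨g, hg, hdg, fun e he hne => Or.inl (hlt e he hne)⟩
  refine le_antisymm (Ideal.span_le.2 ?_) ?_
  · have claim : ∀ a, ∀ f ∈ I, IsLead mo' f a → ∀ d ∈ f.support, wdeg ν ⇑d = wdeg ν ⇑a →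
        d ∈ leadSet mo (I.restrictScalars K) := by
      intro a
      induction a using mo'.wellFounded.induction with
      | _ a ih =>
      intro f hf hfa d hd hda
      have haM : a ∈ leadSet mo (I.restrictScalars K) := hM ▸ ⟨f, hf, hfa⟩
      by_cases hne : d = a
      · rwa [hne]
      obtain ⟨g, hg, hag, hlt⟩ := h a haM
      set f' := f - (f.coeff a / g.coeff a) • g with hf'
      have hf'I : f' ∈ I := I.sub_mem hf ((I.restrictScalars K).smul_mem _ hg)
      have hdg : g.coeff d = 0 := by
        by_contra hdg
        exact (hlt d (mem_support_iff.2 hdg) hne).ne hda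
      have hdf' : d ∈ f'.support := by
        rw [mem_support_iff, hf', coeff_sub, coeff_smul, hdg, smul_zero, sub_zero]
        exact mem_support_iff.1 hd
      have hlt' : ∀ e ∈ f'.support, mo'.lt e a := by
        intro e he
        have hea : e ≠ a := by
          rintro rfl
          rw [mem_support_iff, hf', coeff_sub, coeff_smul, smul_eq_mul,
            div_mul_cancel₀ _ (mem_support_iff.1 hag), sub_self] at he
          exact he rfl
        rcases Finset.mem_union.1 (support_sub _ _ _ he) with h' | h'
        · exact hfa.2 e h' hea
        · exact Or.inl (hlt e (support_smul h') hea)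
      obtain ⟨b, hb⟩ := exists_isLead mo' (p := f') (by
        rintro h0
        simp [h0] at hdf')
      refine ih b (hlt' b hb.1) f' hf'I hb d hdf' (le_antisymm ?_ ?_)
      · by_cases hdb : d = b
        · rw [hdb]
        · exact wdeg_le_of_refineOrder_lt (hb.2 d hdf' hdb)
      · exact hda ▸ wdeg_le_of_refineOrder_lt (hlt' b hb.1)
    rintro _ ⟨f, hf, rfl⟩
    refine mem_ltIdealO.2 fun d hd => ?_
    obtain ⟨hdf, hmax⟩ := mem_support_initForm.1 hd
    obtain ⟨a, ha⟩ := exists_isLead mo' (p := f) (by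
      rintro rfl
      simp at hdf)
    refine claim a f hf ha d hdf (le_antisymm ?_ (hmax a ha.1))
    by_cases hda : d = a
    · rw [hda]
    · exact wdeg_le_of_refineOrder_lt (ha.2 d hdf hda)
  · rw [ltIdealO_eq_span, Ideal.span_le]
    rintro _ ⟨d, hd, rfl⟩
    obtain ⟨g, hg, hdg, hlt⟩ := h d hd
    refine monomial_one_mem_of_monomial_mem (mem_support_iff.1 hdg)
      (Ideal.subset_span ⟨g, hg, ?_⟩)
    ext e
    rw [coeff_initForm, coeff_monomial]
    by_cases hed : d = e
    · subst hed
      rw [if_pos rfl, if_pos]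
      intro e he
      by_cases hed : e = d
      · rw [hed]
      · exact (hlt e he hed).le
    · rw [if_neg hed]
      split_ifs with hmax
      · by_contra hne
        exact (hlt e (mem_support_iff.2 hne) (Ne.symm hed)).not_ge (hmax d hdg)
      · rfl

/-- A monomial order lies over every nonnegative weight it weakly refines. -/
lemma mem_gCone_of_refines {mo : MonoOrder N} (I : Ideal (MvPolynomial (Fin N) K))
    {ω : Fin N → ℝ} (hω : ∀ i, 0 ≤ ω i)
    (href : ∀ a b : Fin N →₀ ℕ, mo.lt a b → wdeg ω ⇑a ≤ wdeg ω ⇑b) : ω ∈ gCone mo I := by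
  obtain ⟨F, hfin, hFM, -, hF⟩ := exists_finite_generators mo I
  choose! g hgI hlead using fun d (hd : d ∈ leadSet mo (I.restrictScalars K)) => hd
  obtain ⟨ρ, hρ, hρlt⟩ := exists_weight mo
    (S := ⋃ d ∈ F, (fun e => (e, d)) '' {e | e ∈ (g d).support ∧ e ≠ d})
    (hfin.biUnion fun d _ => ((Finset.finite_toSet _).subset fun e he => he.1).image _) (by
      intro s hs
      simp only [Set.mem_iUnion] at hs
      obtain ⟨d, hd, e, ⟨he, hne⟩, rfl⟩ := hs
      exact (hlead d (hFM hd)).2 e he hne)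
  have hmem : ∀ ε : ℝ, 0 < ε → ω + ε • ρ ∈
      {ω : Fin N → ℝ | (∀ i, 0 ≤ ω i) ∧ ltIdealW ω I = ltIdealO mo I} := by
    intro ε hε
    have hν : ∀ i, 0 ≤ (ω + ε • ρ) i := fun i => add_nonneg (hω i) (mul_nonneg hε.le (hρ i))
    refine ⟨hν, ltIdealW_eq_ltIdealO hν fun d hd => ?_⟩
    obtain ⟨c, hc, hcd⟩ := hF d hd
    obtain ⟨b, rfl⟩ := exists_add_of_le hcd
    have hgc := hlead c (hFM hc)
    refine ⟨monomial b 1 * g c, I.mul_mem_left _ (hgI c (hFM hc)), (hgc.monomial_mul b).1, ?_⟩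
    intro e he hne
    rw [mem_support_iff, coeff_monomial_mul'] at he
    split_ifs at he with hbe
    · obtain ⟨a, rfl⟩ := exists_add_of_le hbe
      have ha : a ∈ (g c).support := by
        rw [mem_support_iff]
        simpa using he
      have hac : a ≠ c := by
        rintro rfl
        exact hne (add_comm _ _)
      have h1 := href a c (hgc.2 a ha hac)
      have h2 := hρlt (a, c) (Set.mem_biUnion hc ⟨a, ⟨ha, hac⟩, rfl⟩)
      simp only at h2
      rw [wdeg_add, wdeg_add, wdeg_weight_add _ _ ⇑a, wdeg_weight_add _ _ ⇑c,
        wdeg_weight_smul, wdeg_weight_smul]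
      nlinarith
    · exact absurd rfl he
  refine mem_closure_of_tendsto (f := fun ε : ℝ => ω + ε • ρ) (b := nhdsWithin 0 (Set.Ioi 0)) ?_
    (Filter.eventually_of_mem self_mem_nhdsWithin hmem)
  have hcont : Continuous fun ε : ℝ => ω + ε • ρ := by fun_prop
  simpa using (hcont.tendsto 0).mono_left nhdsWithin_le_nhds

end GroebnerCones

/-! ### Elimination vectors -/

section EliminationVectors

lemma wdeg_eq_zero_of_expKX {n : ℕ} {τ : Fin N → ℝ} (hτ : τ ∈ OmegaU n N) {d : Fin N →₀ ℕ}
    (hd : expKX n d) : wdeg τ ⇑d = 0 := by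
  refine Finset.sum_eq_zero fun i _ => ?_
  by_cases hi : (i : ℕ) < n
  · rw [hτ.2 i hi, zero_mul]
  · rw [hd i (not_lt.1 hi), Nat.cast_zero, mul_zero]

/-- Refining an `I`-specific elimination order by a weight of its Gröbner cone keeps it
an `I`-specific elimination order. -/
lemma IsEO.refineOrder {n : ℕ} {mo : MonoOrder N} {I : Ideal (MvPolynomial (Fin N) K)}
    (hmo : IsEO n mo I) {σ : Fin N → ℝ} (hσ : ∀ i, 0 ≤ σ i) (hσmem : σ ∈ gCone mo I) :
    IsEO n (refineOrder σ hσ mo) I := by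
  have hlead : ∀ g ∈ I, ∀ d, IsLead mo g d →
      (∀ e ∈ g.support, e ≠ d → e ∉ leadSet mo (I.restrictScalars K)) →
      IsLead (_root_.refineOrder σ hσ mo) g d := by
    intro g hg d hd htail
    refine ⟨hd.1, fun e he hne => ?_⟩
    rcases (wdeg_le_of_mem_gCone hσmem hg hd.1 htail he).lt_or_eq with h | h
    · exact Or.inl h
    · exact Or.inr ⟨h, hd.2 e he hne⟩
  have hM : leadSet mo (I.restrictScalars K) =
      leadSet (_root_.refineOrder σ hσ mo) (I.restrictScalars K) := by
    refine leadSet_eq_of_subset fun d hd => ?_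
    obtain ⟨g, hg, hgd, -, htail⟩ := exists_tailReduced hd
    exact ⟨g, hg, hlead g hg d hgd htail⟩
  rw [isEO_iff] at hmo ⊢
  intro d hd hdX
  obtain ⟨g, hg, hgd, -, htail⟩ := exists_tailReduced (hmo d (hM ▸ hd) hdX)
  exact ⟨g, hg, hlead g hg.1 d hgd fun e he hne heM => htail e he hne (hmo e heM (hg.2 e he))⟩

lemma isEV_of_mem_OmegaU {n : ℕ} (I : Ideal (MvPolynomial (Fin N) K)) {τ : Fin N → ℝ}
    (hτ : τ ∈ OmegaU n N) : IsEV n I τ := by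
  set υ : Fin N → ℝ := fun i => if (i : ℕ) < n then 0 else 1 with hυ
  have hυ0 : ∀ i, 0 ≤ υ i := by
    intro i
    simp only [hυ]
    split_ifs <;> norm_num
  have hυU : υ ∈ OmegaU n N := ⟨hυ0, fun i hi => if_pos hi⟩
  refine ⟨hτ.1, refineOrder τ hτ.1 (refineOrder υ hυ0 (lexOrder N)), ?_,
    mem_gCone_of_refines I hτ.1 fun a b => wdeg_le_of_refineOrder_lt⟩
  rw [isEO_iff]
  rintro d ⟨f, hf, hfd⟩ hdX
  refine ⟨f, ⟨hf, fun e he => ?_⟩, hfd⟩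
  by_cases hed : e = d
  · rwa [hed]
  have hle : wdeg υ ⇑e ≤ 0 := by
    rcases refineOrder_lt.1 (hfd.2 e he hed) with h | ⟨-, h⟩
    · rw [wdeg_eq_zero_of_expKX hτ hdX] at h
      exact absurd h (wdeg_nonneg hτ.1 _).not_gt
    · exact wdeg_eq_zero_of_expKX hυU hdX ▸ wdeg_le_of_refineOrder_lt h
  have hzero := (Finset.sum_eq_zero_iff_of_nonneg fun i _ =>
    mul_nonneg (hυ0 i) (Nat.cast_nonneg (e i))).1 (hle.antisymm (wdeg_nonneg hυ0 _))
  intro i hi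
  have h := hzero i (Finset.mem_univ i)
  simpa [hυ, not_lt.2 hi] using h

lemma IsEV.add_smul {n : ℕ} {I : Ideal (MvPolynomial (Fin N) K)} {σ τ : Fin N → ℝ}
    (hσ : IsEV n I σ) (hτ : τ ∈ OmegaU n N) {a b : ℝ} (ha : 0 < a) (hb : 0 ≤ b) :
    IsEV n I (a • σ + b • τ) := by
  obtain ⟨hσ0, mo, hEO, hσmem⟩ := hσ
  have hω0 : ∀ i, 0 ≤ (a • σ + b • τ) i := fun i =>
    add_nonneg (mul_nonneg ha.le (hσ0 i)) (mul_nonneg hb (hτ.1 i))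
  have hω : ∀ e : Fin N →₀ ℕ, wdeg (a • σ + b • τ) ⇑e = a * wdeg σ ⇑e + b * wdeg τ ⇑e := by
    intro e
    rw [wdeg_weight_add, wdeg_weight_smul, wdeg_weight_smul]
  have hEO' := hEO.refineOrder hσ0 hσmem
  refine ⟨hω0, refineOrder _ hω0 (refineOrder σ hσ0 mo), ?_,
    mem_gCone_of_refines I hω0 fun _ _ => wdeg_le_of_refineOrder_lt⟩
  rw [isEO_iff] at hEO' ⊢
  rintro d ⟨f, hf, hfd⟩ hdX
  have hτd := wdeg_eq_zero_of_expKX hτ hdX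
  obtain ⟨g, hg, hgd⟩ := hEO' d ⟨f, hf, hfd.1, fun e he hne => by
    have hτe := mul_nonneg hb (wdeg_nonneg hτ.1 ⇑e)
    rcases refineOrder_lt.1 (hfd.2 e he hne) with h | ⟨-, h⟩
    · rw [hω, hω, hτd] at h
      exact Or.inl (lt_of_mul_lt_mul_left (by linarith) ha.le)
    · exact h⟩ hdX
  refine ⟨g, hg, hgd.1, fun e he hne => ?_⟩
  have h := hgd.2 e he hne
  have hτe := wdeg_eq_zero_of_expKX hτ (hg.2 e he)
  rw [refineOrder_lt, hω, hω, hτd, hτe]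
  rcases (wdeg_le_of_refineOrder_lt h).lt_or_eq with h' | h'
  · exact Or.inl (by nlinarith)
  · exact Or.inr ⟨by rw [h'], h⟩

end EliminationVectors

/-- For any ideal `I ⊆ K[X][U]`, the union of the Gröbner cones of all
`I`-specific elimination orders (= the set of `I`-specific elimination vectors) is
star-shaped with center `Ω_u = {ω ∈ Ω : ω_1 = … = ω_n = 0}`: `Ω_u` is contained in it, and
for every `I`-EV `σ` and every `τ ∈ Ω_u`, every point of the segment `[σ, τ]` is an `I`-EV. -/
theorem groebner_EV_starShaped (n m : ℕ) {K : Type*} [Field K]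
    (I : Ideal (MvPolynomial (Fin (n + m)) K)) :
    OmegaU n (n + m) ⊆ {ω : Fin (n + m) → ℝ | IsEV n I ω} ∧
    ∀ σ : Fin (n + m) → ℝ, IsEV n I σ →
      ∀ τ ∈ OmegaU n (n + m), ∀ ω ∈ segment ℝ σ τ, IsEV n I ω := by
  refine ⟨fun τ hτ => isEV_of_mem_OmegaU I hτ, fun σ hσ τ hτ ω hω => ?_⟩
  obtain ⟨a, b, ha, hb, hab, rfl⟩ := hω
  rcases ha.lt_or_eq with ha | rfl
  · exact hσ.add_smul hτ ha hb
  · obtain rfl : b = 1 := by linarith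
    simpa using isEV_of_mem_OmegaU I hτ
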